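/- Let S be an order in L, let T be an order in L with σ(T) = T, let 𝒯 ⊆ Tˣ be a finite transversal of Tˣ modulo H, let b ∈ L be nonzero totally imaginary, let r be a positive integer, and let i₁, …, i_r be nonzero elements of L. For a nonzero totally imaginary d ∈ L and 1 ≤ k ≤ r set P_k(Φ_d) := {i_k·u : u ∈ 𝒯 such that i_k·u is totally imaginary and Φ_d-positive}. Then the following are equivalent: (1) there exists N ∈ ℕ such that for every totally real unit c of S one has |P_1(Φ_{c·b})| + … + |P_r(Φ_{c·b})| = N; (2) there exist N₁, …, N_r ∈ ℕ such that for every totally real unit c of S the tuple (|P_1(Φ_{c·b})|, …, |P_r(Φ_{c·b})|) is a permutation of (N₁, …, N_r). -/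

import Mathlib

variable {L : Type*} [Field L] [NumberField L]

/-- `x ∈ L` is totally real w.r.t. the CM involution `σ`. -/
def TotallyReal (σ : L ≃ₐ[ℚ] L) (x : L) : Prop := σ x = x

/-- `x ∈ L` is totally imaginary w.r.t. the CM involution `σ`. -/
def TotallyImaginary (σ : L ≃ₐ[ℚ] L) (x : L) : Prop := σ x = -x

/-- `x ∈ L` is totally positive: totally real and every complex embedding sends it to a
positive real number. -/
def TotallyPositive (σ : L ≃ₐ[ℚ] L) (x : L) : Prop :=
  σ x = x ∧ ∀ φ : L →+* ℂ, (φ x).im = 0 ∧ 0 < (φ x).re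

/-- The CM-type `Φ_b` attached to a (nonzero totally imaginary) element `b ∈ L`:
the set of complex embeddings `φ` with `Im (φ b) > 0`. -/
def CMType (b : L) : Set (L →+* ℂ) := {φ | 0 < (φ b).im}

/-- `x ∈ L` is `Φ_b`-positive: `Im (φ x) > 0` for every `φ ∈ Φ_b`. -/
def PhiPositive (b x : L) : Prop := ∀ φ ∈ CMType b, 0 < (φ x).im

/-- A unit of an order (subring) `T` of `L`: an element of `T` with an inverse in `T`. -/
def IsUnitOfOrder (T : Subring L) (u : L) : Prop := u ∈ T ∧ ∃ v ∈ T, u * v = 1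

/-- An order in `L`: a subring which is finitely generated as a `ℤ`-module and contains a
`ℚ`-basis of `L` (i.e. spans `L` over `ℚ`). -/
def IsOrder (T : Subring L) : Prop :=
  (Submodule.span ℤ (T : Set L)).FG ∧ Submodule.span ℚ (T : Set L) = ⊤

/-- `𝒯` is a transversal of `Tˣ` modulo the subgroup `H` generated by
`{v·σ(v) : v ∈ Tˣ}` (when `σ(T) = T` this generating set is itself a subgroup, since it is
closed under products and inverses, so `H = {v·σ(v) : v ∈ Tˣ}`): every unit of `T` is
congruent modulo `H` to exactly one element of `𝒯`. -/
def IsTransversal (σ : L ≃ₐ[ℚ] L) (T : Subring L) (𝒯 : Set L) : Prop :=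
  (∀ u ∈ 𝒯, IsUnitOfOrder T u) ∧
  ∀ u : L, IsUnitOfOrder T u →
    ∃! t : L, t ∈ 𝒯 ∧ ∃ v : L, IsUnitOfOrder T v ∧ u = t * (v * σ v)

/-- The set `P_α(Φ_b) = {i₀·u : u ∈ 𝒯 such that α⁻¹·i₀·u is totally imaginary and
Φ_b-positive}`; the set `P_1(Φ_b)` is the special case `α = 1`. -/
def Pset (σ : L ≃ₐ[ℚ] L) (𝒯 : Set L) (i₀ α b : L) : Set L :=
  {x | ∃ u ∈ 𝒯, x = i₀ * u ∧ TotallyImaginary σ (α⁻¹ * (i₀ * u)) ∧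
    PhiPositive b (α⁻¹ * (i₀ * u))}

/-- Two functions to `{0, m}` with the same sum differ by a permutation of the indices. -/
theorem exists_perm_of_sum_eq_of_zero_or_eq {ι : Type*} [Fintype ι] {m : ℕ} {f g : ι → ℕ}
    (hf : ∀ k, f k = 0 ∨ f k = m) (hg : ∀ k, g k = 0 ∨ g k = m)
    (h : ∑ k, f k = ∑ k, g k) : ∃ π : Equiv.Perm ι, ∀ k, f k = g (π k) := by
  classical
  rcases Nat.eq_zero_or_pos m with rfl | hm
  · simp only [or_self] at hf hg
    exact ⟨1, fun k => by rw [hf, hg]⟩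
  have sum_eq : ∀ f : ι → ℕ, (∀ k, f k = 0 ∨ f k = m) →
      ∑ k, f k = Fintype.card {k // f k = m} * m := by
    intro f hf
    rw [Fintype.card_subtype, ← smul_eq_mul, ← Finset.sum_const, Finset.sum_filter]
    refine Finset.sum_congr rfl fun k _ => ?_
    have := hf k
    split_ifs <;> lia
  rw [sum_eq f hf, sum_eq g hg] at h
  have e := Fintype.equivOfCardEq (Nat.eq_of_mul_eq_mul_right hm h)
  refine ⟨e.extendSubtype, fun k => ?_⟩
  by_cases hk : f k = m
  · exact hk.trans (e.extendSubtype_mem k hk).symm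
  · have hk' := e.extendSubtype_not_mem k hk
    rw [(hf k).resolve_right hk, (hg _).resolve_right hk']

theorem IsUnitOfOrder.mul {K : Type*} [Field K] {T : Subring K} {u v : K} (hu : IsUnitOfOrder T u)
    (hv : IsUnitOfOrder T v) : IsUnitOfOrder T (u * v) := by
  obtain ⟨hu, u', hu', hu1⟩ := hu
  obtain ⟨hv, v', hv', hv1⟩ := hv
  exact ⟨T.mul_mem hu hv, u' * v', T.mul_mem hu' hv', by rw [mul_mul_mul_comm, hu1, hv1, one_mul]⟩

theorem IsUnitOfOrder.ne_zero {K : Type*} [Field K] {T : Subring K} {u : K}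
    (hu : IsUnitOfOrder T u) : u ≠ 0 := by
  obtain ⟨-, v, -, h⟩ := hu
  exact left_ne_zero_of_mul_eq_one h

theorem IsUnitOfOrder.inv {K : Type*} [Field K] {T : Subring K} {u : K} (hu : IsUnitOfOrder T u) :
    IsUnitOfOrder T u⁻¹ := by
  have h0 := hu.ne_zero
  obtain ⟨hu, v, hv, h⟩ := hu
  rw [inv_eq_of_mul_eq_one_right h]
  exact ⟨hv, u, hu, by rwa [mul_comm]⟩

theorem isUnitOfOrder_one {K : Type*} [Field K] (T : Subring K) : IsUnitOfOrder T 1 :=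
  ⟨T.one_mem, 1, T.one_mem, one_mul 1⟩

theorem TotallyPositive.mul {σ : L ≃ₐ[ℚ] L} {x y : L} (hx : TotallyPositive σ x)
    (hy : TotallyPositive σ y) : TotallyPositive σ (x * y) := by
  refine ⟨by rw [map_mul, hx.1, hy.1], fun φ => ?_⟩
  obtain ⟨hx0, hx1⟩ := hx.2 φ
  obtain ⟨hy0, hy1⟩ := hy.2 φ
  simp only [map_mul, Complex.mul_im, Complex.mul_re, hx0, hy0]
  constructor <;> simp [hx1, hy1]

theorem TotallyPositive.inv {σ : L ≃ₐ[ℚ] L} {x : L} (hx : TotallyPositive σ x) :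
    TotallyPositive σ x⁻¹ := by
  refine ⟨by rw [map_inv₀, hx.1], fun φ => ?_⟩
  obtain ⟨hx0, hx1⟩ := hx.2 φ
  rw [map_inv₀, Complex.inv_im, Complex.inv_re, hx0]
  refine ⟨by simp, div_pos hx1 (Complex.normSq_pos.2 fun h => ?_)⟩
  simp [h] at hx1

theorem totallyPositive_mul_conj {σ : L ≃ₐ[ℚ] L}
    (hσ : ∀ (φ : L →+* ℂ) (x : L), φ (σ x) = (starRingEnd ℂ) (φ x)) {v : L} (hv : v ≠ 0) :
    TotallyPositive σ (v * σ v) := by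
  have key : ∀ φ : L →+* ℂ, φ (v * σ v) = (Complex.normSq (φ v) : ℂ) := fun φ => by
    rw [map_mul, hσ, Complex.mul_conj]
  constructor
  · obtain ⟨φ⟩ : Nonempty (L →+* ℂ) := inferInstance
    apply φ.injective
    rw [hσ, key, Complex.conj_ofReal]
  · intro φ
    rw [key]
    exact ⟨Complex.ofReal_im _, by simpa using hv⟩

theorem TotallyImaginary.re_eq_zero {σ : L ≃ₐ[ℚ] L}
    (hσ : ∀ (φ : L →+* ℂ) (x : L), φ (σ x) = (starRingEnd ℂ) (φ x)) {x : L}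
    (hx : TotallyImaginary σ x) (φ : L →+* ℂ) : (φ x).re = 0 := by
  have h := congrArg Complex.re (hσ φ x)
  rw [hx, map_neg, Complex.neg_re, Complex.conj_re] at h
  linarith

/-- The imaginary parts of a totally imaginary `Φ_d`-positive element have the same sign as those
of `d` at every complex embedding. -/
theorem PhiPositive.mul_im_pos {σ : L ≃ₐ[ℚ] L}
    (hσ : ∀ (φ : L →+* ℂ) (x : L), φ (σ x) = (starRingEnd ℂ) (φ x)) {d x : L} (hd0 : d ≠ 0)
    (hd : TotallyImaginary σ d) (hx : TotallyImaginary σ x) (hpos : PhiPositive d x)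
    (φ : L →+* ℂ) : 0 < (φ d).im * (φ x).im := by
  rcases lt_trichotomy (φ d).im 0 with h | h | h
  · have hconj := hpos (φ.comp (σ : L →+* L)) (by
      change 0 < (φ (σ d)).im
      rw [hd, map_neg, Complex.neg_im]
      linarith)
    change 0 < (φ (σ x)).im at hconj
    rw [hx, map_neg, Complex.neg_im] at hconj
    exact mul_pos_of_neg_of_neg h (by linarith)
  · exact absurd ((map_eq_zero φ).1 (Complex.ext (hd.re_eq_zero hσ φ) h)) hd0
  · exact mul_pos h (hpos φ h)

theorem totallyPositive_div_of_phiPositive {σ : L ≃ₐ[ℚ] L}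
    (hσ : ∀ (φ : L →+* ℂ) (x : L), φ (σ x) = (starRingEnd ℂ) (φ x)) {d x y : L} (hd0 : d ≠ 0)
    (hd : TotallyImaginary σ d) (hx : TotallyImaginary σ x) (hxpos : PhiPositive d x)
    (hy : TotallyImaginary σ y) (hypos : PhiPositive d y) : TotallyPositive σ (x / y) := by
  refine ⟨by rw [map_div₀, hx, hy, neg_div_neg_eq], fun φ => ?_⟩
  have hx1 := hxpos.mul_im_pos hσ hd0 hd hx φ
  have hy1 := hypos.mul_im_pos hσ hd0 hd hy φ
  have hxy : 0 < (φ x).im * (φ y).im := by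
    have : 0 < (φ d).im ^ 2 * ((φ x).im * (φ y).im) := by
      rw [sq, mul_mul_mul_comm]
      exact mul_pos hx1 hy1
    exact pos_of_mul_pos_right this (sq_nonneg _)
  have hx0 := hx.re_eq_zero hσ φ
  have hy0 := hy.re_eq_zero hσ φ
  have hn : 0 < Complex.normSq (φ y) := Complex.normSq_pos.2 fun h => by simp [h] at hxy
  rw [map_div₀, Complex.div_im, Complex.div_re, hx0, hy0]
  refine ⟨by simp, ?_⟩
  simpa using div_pos hxy hn

theorem TotallyImaginary.mul_totallyPositive {σ : L ≃ₐ[ℚ] L} {x q : L}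
    (hx : TotallyImaginary σ x) (hq : TotallyPositive σ q) : TotallyImaginary σ (x * q) := by
  rw [TotallyImaginary, map_mul, hx, hq.1, neg_mul]

theorem PhiPositive.mul_totallyPositive {σ : L ≃ₐ[ℚ] L} {d x q : L}
    (hx : PhiPositive d x) (hq : TotallyPositive σ q) : PhiPositive d (x * q) := by
  intro φ hφ
  obtain ⟨hq0, hq1⟩ := hq.2 φ
  rw [map_mul, Complex.mul_im, hq0, mul_zero, zero_add]
  exact mul_pos (hx φ hφ) hq1

/-- The number of representatives in a given coset of the totally positive units does not
depend on the coset. -/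
theorem IsTransversal.ncard_totallyPositive_div_le {σ : L ≃ₐ[ℚ] L}
    (hσ : ∀ (φ : L →+* ℂ) (x : L), φ (σ x) = (starRingEnd ℂ) (φ x))
    {T : Subring L} {𝒯 : Set L} (h𝒯 : IsTransversal σ T 𝒯) (hfin : 𝒯.Finite) {a b : L}
    (ha : IsUnitOfOrder T a) (hb : IsUnitOfOrder T b) :
    {u ∈ 𝒯 | TotallyPositive σ (u / a)}.ncard ≤ {u ∈ 𝒯 | TotallyPositive σ (u / b)}.ncard := by
  have ha0 := ha.ne_zero
  have hb0 := hb.ne_zero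
  have hw : IsUnitOfOrder T (b * a⁻¹) := hb.mul ha.inv
  have hex : ∀ u ∈ 𝒯, ∃ t ∈ 𝒯, ∃ v, IsUnitOfOrder T v ∧ u * (b * a⁻¹) = t * (v * σ v) :=
    fun u hu => by
      obtain ⟨t, ⟨ht, hv⟩, -⟩ := h𝒯.2 _ ((h𝒯.1 u hu).mul hw)
      exact ⟨t, ht, hv⟩
  choose! rep hrep v hv huv using hex
  refine Set.ncard_le_ncard_of_injOn rep ?_ ?_ (hfin.subset (Set.sep_subset _ _))
  · rintro u ⟨hu, hpos⟩
    refine ⟨hrep u hu, ?_⟩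
    have hn := totallyPositive_mul_conj hσ (hv u hu).ne_zero
    have hn0 : v u * σ (v u) ≠ 0 :=
      mul_ne_zero (hv u hu).ne_zero (by simpa using (hv u hu).ne_zero)
    convert hpos.mul hn.inv using 1
    have := huv u hu
    rw [eq_mul_inv_iff_mul_eq₀ hn0, div_mul_eq_mul_div, ← this]
    field_simp
  · rintro u ⟨hu, -⟩ u' ⟨hu', -⟩ h
    have e := huv u hu
    have e' := huv u' hu'
    rw [h] at e
    obtain ⟨t, -, huniq⟩ := h𝒯.2 u (h𝒯.1 u hu)
    have h1 : u = t := huniq u ⟨hu, 1, isUnitOfOrder_one T, by simp⟩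
    refine h1.trans (huniq u' ⟨hu', v u * (v u')⁻¹, (hv u hu).mul (hv u' hu').inv, ?_⟩).symm
    have hv0 := (hv u' hu').ne_zero
    have hv0' : σ (v u') ≠ 0 := by simpa using hv0
    apply mul_right_cancel₀ hw.ne_zero
    rw [e, mul_right_comm, e', map_mul, map_inv₀]
    field_simp

/-- Each `P_k(Φ_d)` is empty or as large as the set of totally positive representatives. -/
theorem ncard_Pset_eq_zero_or_eq {σ : L ≃ₐ[ℚ] L}
    (hσ : ∀ (φ : L →+* ℂ) (x : L), φ (σ x) = (starRingEnd ℂ) (φ x))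
    {T : Subring L} {𝒯 : Set L} (h𝒯 : IsTransversal σ T 𝒯) (hfin : 𝒯.Finite)
    {d i₀ : L} (hd0 : d ≠ 0) (hd : TotallyImaginary σ d) (hi : i₀ ≠ 0) :
    (Pset σ 𝒯 i₀ 1 d).ncard = 0 ∨
      (Pset σ 𝒯 i₀ 1 d).ncard = {u ∈ 𝒯 | TotallyPositive σ (u / 1)}.ncard := by
  rcases (Pset σ 𝒯 i₀ 1 d).eq_empty_or_nonempty with h | ⟨-, u₀, hu₀, -, him, hpos⟩
  · exact Or.inl (by rw [h, Set.ncard_empty])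
  right
  rw [inv_one, one_mul] at him hpos
  have hu := h𝒯.1 u₀ hu₀
  have hu0 := hu.ne_zero
  have key : Pset σ 𝒯 i₀ 1 d = (i₀ * ·) '' {u ∈ 𝒯 | TotallyPositive σ (u / u₀)} := by
    ext x
    simp only [Pset, inv_one, one_mul, Set.mem_ofPred_eq, Set.mem_image]
    constructor
    · rintro ⟨u, hu, rfl, h1, h2⟩
      refine ⟨u, ⟨hu, ?_⟩, rfl⟩
      rw [← mul_div_mul_left u u₀ hi]
      exact totallyPositive_div_of_phiPositive hσ hd0 hd h1 h2 him hpos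
    · rintro ⟨u, ⟨hu, hq⟩, rfl⟩
      have e : i₀ * u = i₀ * u₀ * (u / u₀) := by field_simp
      refine ⟨u, hu, rfl, ?_, ?_⟩
      · rw [e]
        exact him.mul_totallyPositive hq
      · rw [e]
        exact hpos.mul_totallyPositive hq
  rw [key, Set.ncard_image_of_injective _ (mul_right_injective₀ hi)]
  exact le_antisymm
    (h𝒯.ncard_totallyPositive_div_le hσ hfin hu (isUnitOfOrder_one T))
    (h𝒯.ncard_totallyPositive_div_le hσ hfin (isUnitOfOrder_one T) hu)

/-- Theorem 5.13 / `sameoutput`: With `S`, `T` orders in `L`, `T` stable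
under `σ`, `𝒯` a finite transversal of `Tˣ` modulo `H`, `b ∈ L` nonzero totally
imaginary, `r` a positive integer and `i₁, …, i_r` nonzero elements of `L`, with
`P_k(Φ_d) = {i_k·u : u ∈ 𝒯, i_k·u totally imaginary and Φ_d-positive}`, the following are
equivalent: (1) there is `N ∈ ℕ` with `|P_1(Φ_{c·b})| + … + |P_r(Φ_{c·b})| = N` for every
totally real unit `c` of `S`; (2) there are `N₁, …, N_r ∈ ℕ` such that for every totally
real unit `c` of `S` the tuple `(|P_1(Φ_{c·b})|, …, |P_r(Φ_{c·b})|)` is a permutation of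
`(N₁, …, N_r)`. -/
theorem sum_card_const_iff_tuple_perm_const (σ : L ≃ₐ[ℚ] L)
    (hσ : ∀ (φ : L →+* ℂ) (x : L), φ (σ x) = (starRingEnd ℂ) (φ x))
    (S T : Subring L) (hS : IsOrder S) (hT : IsOrder T)
    (hTσ : ∀ x : L, σ x ∈ T ↔ x ∈ T)
    (𝒯 : Set L) (h𝒯 : IsTransversal σ T 𝒯) (h𝒯fin : 𝒯.Finite)
    (b : L) (hb0 : b ≠ 0) (hb : TotallyImaginary σ b)
    (r : ℕ) (hr : 0 < r) (i : Fin r → L) (hi : ∀ k, i k ≠ 0) :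
    (∃ N : ℕ, ∀ c : L, TotallyReal σ c → IsUnitOfOrder S c →
        ∑ k : Fin r, (Pset σ 𝒯 (i k) 1 (c * b)).ncard = N) ↔
    (∃ N : Fin r → ℕ, ∀ c : L, TotallyReal σ c → IsUnitOfOrder S c →
        ∃ π : Equiv.Perm (Fin r),
          ∀ k : Fin r, (Pset σ 𝒯 (i k) 1 (c * b)).ncard = N (π k)) := by
  constructor
  · rintro ⟨N, hN⟩
    have h1 : TotallyReal σ 1 := map_one σ
    refine ⟨fun k => (Pset σ 𝒯 (i k) 1 (1 * b)).ncard, fun c hc hcS => ?_⟩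
    have dichotomy : ∀ c : L, TotallyReal σ c → IsUnitOfOrder S c → ∀ k,
        (Pset σ 𝒯 (i k) 1 (c * b)).ncard = 0 ∨ (Pset σ 𝒯 (i k) 1 (c * b)).ncard =
          {u ∈ 𝒯 | TotallyPositive σ (u / 1)}.ncard := fun c hc hcS k =>
      ncard_Pset_eq_zero_or_eq hσ h𝒯 h𝒯fin (mul_ne_zero hcS.ne_zero hb0)
        (by rw [TotallyImaginary, map_mul, hc, hb, mul_neg]) (hi k)
    exact exists_perm_of_sum_eq_of_zero_or_eq (dichotomy c hc hcS)
      (dichotomy 1 h1 (isUnitOfOrder_one S))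
      ((hN c hc hcS).trans (hN 1 h1 (isUnitOfOrder_one S)).symm)
  · rintro ⟨N, hN⟩
    refine ⟨∑ k, N k, fun c hc hcS => ?_⟩
    obtain ⟨π, hπ⟩ := hN c hc hcS
    rw [Finset.sum_congr rfl fun k _ => hπ k, Equiv.sum_comp π N]
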